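/- Let Σ be a submanifold of (M,η) with an almost Kähler–Poisson structure of characteristic function γ², and let R̄ be the curvature tensor of M. Then the Codazzi–Mainardi equations take the form: for all X,Y,Z ∈ TΣ and each normal vector N_A, X^i Y^j Z^k N_A^l R̄_{ijkl} = X_i Y_j Z_k [ ∇̂^i ∇̂^k N_A^j − ∇̂^j ∇̂^k N_A^i + ∇̂^k ∇̂^j N_A^i − ∇̂^k ∇̂^i N_A^j ]. -/

import Mathlib

open scoped BigOperators

namespace KP

/-- Partial derivative of a real-valued function on `ℝ^k` in the `a`-th coordinate
direction. -/
noncomputable def pd {k : ℕ} (a : Fin k) (f : (Fin k → ℝ) → ℝ) (p : Fin k → ℝ) : ℝ :=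
  fderiv ℝ f p (Pi.single a 1)

variable {n m : ℕ}

/-- The Poisson bracket `{f,g} = θ^{ab} (∂_a f)(∂_b g)` associated to a bivector `θ`. -/
noncomputable def pbr (θ : (Fin n → ℝ) → Fin n → Fin n → ℝ)
    (f g : (Fin n → ℝ) → ℝ) (p : Fin n → ℝ) : ℝ :=
  ∑ a, ∑ b, θ p a b * pd a f p * pd b g p

/-- Antisymmetry of a bivector. -/
def Antisymm (θ : (Fin n → ℝ) → Fin n → Fin n → ℝ) : Prop :=
  ∀ p a b, θ p a b = - θ p b a

/-- The Jacobi identity for a bivector `θ` (so that `θ` is a Poisson bivector). -/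
def JacobiId (θ : (Fin n → ℝ) → Fin n → Fin n → ℝ) : Prop :=
  ∀ p a b c, ∑ d, (θ p a d * pd d (fun q => θ q b c) p
    + θ p b d * pd d (fun q => θ q c a) p
    + θ p c d * pd d (fun q => θ q a b) p) = 0

/-- Smoothness of a field with two indices. -/
def Smooth2 {k l k' : ℕ} (f : (Fin k → ℝ) → Fin l → Fin k' → ℝ) : Prop :=
  ∀ i j, ContDiff ℝ (⊤ : ℕ∞) fun q => f q i j

/-- A Riemannian metric `g` in local coordinates, with given inverse `gi`:
smoothness, symmetry, positive definiteness and the inverse property. -/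
def IsMetric {k : ℕ} (g gi : (Fin k → ℝ) → Fin k → Fin k → ℝ) : Prop :=
  Smooth2 g ∧
  (∀ q i j, g q i j = g q j i) ∧
  (∀ (q : Fin k → ℝ) (v : Fin k → ℝ), v ≠ 0 → 0 < ∑ i, ∑ j, g q i j * v i * v j) ∧
  (∀ q i j, (∑ l, g q i l * gi q l j) = if i = j then (1:ℝ) else 0)

/-- Christoffel symbols `Γ^a_{bc}` of the Levi-Civita connection of the metric `g`
(with inverse `gi`). -/
noncomputable def Chr {k : ℕ} (g gi : (Fin k → ℝ) → Fin k → Fin k → ℝ)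
    (q : Fin k → ℝ) (a b c : Fin k) : ℝ :=
  (1/2) * ∑ d, gi q a d *
    (pd b (fun r => g r d c) q + pd c (fun r => g r d b) q - pd d (fun r => g r b c) q)

/-- The Riemann curvature tensor `R^a_{bcd}` of the Levi-Civita connection of `g`,
with the convention `R(e_c, e_d) e_b = R^a_{bcd} e_a`. -/
noncomputable def Riem {k : ℕ} (g gi : (Fin k → ℝ) → Fin k → Fin k → ℝ)
    (q : Fin k → ℝ) (a b c d : Fin k) : ℝ :=
  pd c (fun r => Chr g gi r a d b) q - pd d (fun r => Chr g gi r a c b) q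
  + ∑ e, (Chr g gi q a c e * Chr g gi q e d b - Chr g gi q a d e * Chr g gi q e c b)

/-- The fully lowered curvature tensor `R_{abcd} = g_{ae} R^e_{bcd}`, so that
`R(X,Y,Z,V) = g(R(Z,V)Y, X) = R_{abcd} X^a Y^b Z^c V^d`. -/
noncomputable def RiemL {k : ℕ} (g gi : (Fin k → ℝ) → Fin k → Fin k → ℝ)
    (q : Fin k → ℝ) (a b c d : Fin k) : ℝ :=
  ∑ e, g q a e * Riem g gi q e b c d

/-- The induced metric `g_{ab} = η_{ij} (∂_a x^i)(∂_b x^j)` on the submanifold `Σ`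
embedded via `x` in `(M,η)`. -/
noncomputable def ind (η : (Fin m → ℝ) → Fin m → Fin m → ℝ)
    (x : (Fin n → ℝ) → Fin m → ℝ) (p : Fin n → ℝ) (a b : Fin n) : ℝ :=
  ∑ i, ∑ j, η (x p) i j * pd a (fun q => x q i) p * pd b (fun q => x q j) p

/-- Smoothness of the embedding. -/
def SmoothEmb (x : (Fin n → ℝ) → Fin m → ℝ) : Prop :=
  ∀ i, ContDiff ℝ (⊤ : ℕ∞) fun q => x q i

/-- `θ` is an almost Kähler–Poisson structure on `Σ` (with induced metric of inverse
`gi`) with characteristic function `γ2`:  `θ` is a smooth Poisson bivector, `γ2` is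
smooth and strictly positive, and `γ² g^{ab} = θ^{ap} θ^{bq} g_{pq}`. -/
def IsAKP (η : (Fin m → ℝ) → Fin m → Fin m → ℝ) (x : (Fin n → ℝ) → Fin m → ℝ)
    (θ : (Fin n → ℝ) → Fin n → Fin n → ℝ) (γ2 : (Fin n → ℝ) → ℝ)
    (gi : (Fin n → ℝ) → Fin n → Fin n → ℝ) : Prop :=
  Antisymm θ ∧ JacobiId θ ∧ Smooth2 θ ∧ Smooth2 gi ∧
  ContDiff ℝ (⊤ : ℕ∞) γ2 ∧ (∀ p, 0 < γ2 p) ∧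
  (∀ p a b, (∑ c, ind η x p a c * gi p c b) = if a = b then (1:ℝ) else 0) ∧
  (∀ p a b, γ2 p * gi p a b = ∑ c, ∑ d, θ p a c * θ p b d * ind η x p c d)

/-- `P^{ij} = {x^i, x^j}`. -/
noncomputable def Pbig (x : (Fin n → ℝ) → Fin m → ℝ)
    (θ : (Fin n → ℝ) → Fin n → Fin n → ℝ) (p : Fin n → ℝ) (i j : Fin m) : ℝ :=
  pbr θ (fun q => x q i) (fun q => x q j) p

/-- The map `P : TM → TM`, `P(X)^i = P^{ij} η_{jk} X^k`. -/
noncomputable def Pmap (η : (Fin m → ℝ) → Fin m → Fin m → ℝ)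
    (x : (Fin n → ℝ) → Fin m → ℝ) (θ : (Fin n → ℝ) → Fin n → Fin n → ℝ)
    (p : Fin n → ℝ) (X : Fin m → ℝ) (i : Fin m) : ℝ :=
  ∑ j, ∑ k, Pbig x θ p i j * η (x p) j k * X k

/-- `D^i(u) = γ^{-2} {u, x^k}{x^i, x^l} η_{kl}`. -/
noncomputable def Dop (η : (Fin m → ℝ) → Fin m → Fin m → ℝ)
    (x : (Fin n → ℝ) → Fin m → ℝ) (θ : (Fin n → ℝ) → Fin n → Fin n → ℝ)
    (γ2 : (Fin n → ℝ) → ℝ) (u : (Fin n → ℝ) → ℝ) (p : Fin n → ℝ) (i : Fin m) : ℝ :=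
  (γ2 p)⁻¹ * ∑ k, ∑ l, pbr θ u (fun q => x q k) p
    * pbr θ (fun q => x q i) (fun q => x q l) p * η (x p) k l

/-- `D^{ik} = D^i(x^k)`. -/
noncomputable def Dmat (η : (Fin m → ℝ) → Fin m → Fin m → ℝ)
    (x : (Fin n → ℝ) → Fin m → ℝ) (θ : (Fin n → ℝ) → Fin n → Fin n → ℝ)
    (γ2 : (Fin n → ℝ) → ℝ) (p : Fin n → ℝ) (i k : Fin m) : ℝ :=
  Dop η x θ γ2 (fun q => x q k) p i

/-- `Π^{ij} = η^{ij} − D^{ij}`, the projection onto the normal space. -/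
noncomputable def PiU (η ηi : (Fin m → ℝ) → Fin m → Fin m → ℝ)
    (x : (Fin n → ℝ) → Fin m → ℝ) (θ : (Fin n → ℝ) → Fin n → Fin n → ℝ)
    (γ2 : (Fin n → ℝ) → ℝ) (p : Fin n → ℝ) (i j : Fin m) : ℝ :=
  ηi (x p) i j - Dmat η x θ γ2 p i j

/-- The lowered projection `Π_{ij} = η_{ij} − D_{ij}`. -/
noncomputable def PiL (η : (Fin m → ℝ) → Fin m → Fin m → ℝ)
    (x : (Fin n → ℝ) → Fin m → ℝ) (θ : (Fin n → ℝ) → Fin n → Fin n → ℝ)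
    (γ2 : (Fin n → ℝ) → ℝ) (p : Fin n → ℝ) (i j : Fin m) : ℝ :=
  η (x p) i j - ∑ k, ∑ l, η (x p) i k * η (x p) j l * Dmat η x θ γ2 p k l

/-- The ambient components `X^i = c^a ∂_a x^i` of the tangent field with coefficient
functions `c`. -/
noncomputable def tv (x : (Fin n → ℝ) → Fin m → ℝ) (c : (Fin n → ℝ) → Fin n → ℝ)
    (p : Fin n → ℝ) (i : Fin m) : ℝ :=
  ∑ a, c p a * pd a (fun q => x q i) p

/-- Lowering an ambient index along `Σ` : `V_i = η_{ij} V^j`. -/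
noncomputable def low (η : (Fin m → ℝ) → Fin m → Fin m → ℝ)
    (x : (Fin n → ℝ) → Fin m → ℝ) (V : (Fin n → ℝ) → Fin m → ℝ)
    (p : Fin n → ℝ) (i : Fin m) : ℝ :=
  ∑ j, η (x p) i j * V p j

/-- The ambient inner product `η(V,W)` along `Σ`. -/
noncomputable def ipM (η : (Fin m → ℝ) → Fin m → Fin m → ℝ)
    (x : (Fin n → ℝ) → Fin m → ℝ) (V W : (Fin n → ℝ) → Fin m → ℝ)
    (p : Fin n → ℝ) : ℝ :=
  ∑ i, ∑ j, η (x p) i j * V p i * W p j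

/-- The ambient covariant derivative `(∇̄_{e_a} V)^i` of an ambient-vector field `V`
along `Σ`. -/
noncomputable def barD (η ηi : (Fin m → ℝ) → Fin m → Fin m → ℝ)
    (x : (Fin n → ℝ) → Fin m → ℝ) (V : (Fin n → ℝ) → Fin m → ℝ)
    (p : Fin n → ℝ) (a : Fin n) (i : Fin m) : ℝ :=
  pd a (fun q => V q i) p
    + ∑ k, ∑ l, Chr η ηi (x p) i k l * pd a (fun q => x q k) p * V p l

/-- `∇̂^i u = D^i(u)` on scalars. -/
noncomputable def nhS (η : (Fin m → ℝ) → Fin m → Fin m → ℝ)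
    (x : (Fin n → ℝ) → Fin m → ℝ) (θ : (Fin n → ℝ) → Fin n → Fin n → ℝ)
    (γ2 : (Fin n → ℝ) → ℝ) (u : (Fin n → ℝ) → ℝ) (p : Fin n → ℝ) (i : Fin m) : ℝ :=
  Dop η x θ γ2 u p i

/-- `∇̂^i V^j = D^i(V^j) + D^{ik} Γ̄^j_{kl} V^l` for ambient-vector fields `V` along `Σ`. -/
noncomputable def nhV (η ηi : (Fin m → ℝ) → Fin m → Fin m → ℝ)
    (x : (Fin n → ℝ) → Fin m → ℝ) (θ : (Fin n → ℝ) → Fin n → Fin n → ℝ)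
    (γ2 : (Fin n → ℝ) → ℝ) (V : (Fin n → ℝ) → Fin m → ℝ)
    (p : Fin n → ℝ) (i j : Fin m) : ℝ :=
  Dop η x θ γ2 (fun q => V q j) p i
    + ∑ k, ∑ l, Dmat η x θ γ2 p i k * Chr η ηi (x p) j k l * V p l

/-- `∇̂^i T^{jk}` for `2`-contravariant tensor fields `T` along `Σ`. -/
noncomputable def nhT2 (η ηi : (Fin m → ℝ) → Fin m → Fin m → ℝ)
    (x : (Fin n → ℝ) → Fin m → ℝ) (θ : (Fin n → ℝ) → Fin n → Fin n → ℝ)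
    (γ2 : (Fin n → ℝ) → ℝ) (T : (Fin n → ℝ) → Fin m → Fin m → ℝ)
    (p : Fin n → ℝ) (i j k : Fin m) : ℝ :=
  Dop η x θ γ2 (fun q => T q j k) p i
    + ∑ l, ∑ l', Dmat η x θ γ2 p i l * Chr η ηi (x p) j l l' * T p l' k
    + ∑ l, ∑ l', Dmat η x θ γ2 p i l * Chr η ηi (x p) k l l' * T p j l'

/-- `∇̂^i T_{jk}` for `2`-covariant tensor fields `T` along `Σ`. -/
noncomputable def nhT02 (η ηi : (Fin m → ℝ) → Fin m → Fin m → ℝ)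
    (x : (Fin n → ℝ) → Fin m → ℝ) (θ : (Fin n → ℝ) → Fin n → Fin n → ℝ)
    (γ2 : (Fin n → ℝ) → ℝ) (T : (Fin n → ℝ) → Fin m → Fin m → ℝ)
    (p : Fin n → ℝ) (i j k : Fin m) : ℝ :=
  Dop η x θ γ2 (fun q => T q j k) p i
    - ∑ l, ∑ l', Dmat η x θ γ2 p i l * Chr η ηi (x p) l' l j * T p l' k
    - ∑ l, ∑ l', Dmat η x θ γ2 p i l * Chr η ηi (x p) l' l k * T p j l'

/-- The second fundamental form `α(X,Y) = Π(∇̂_X Y)` (ambient components) for tangent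
fields with coefficients `c`, `d`. -/
noncomputable def sff (η ηi : (Fin m → ℝ) → Fin m → Fin m → ℝ)
    (x : (Fin n → ℝ) → Fin m → ℝ) (θ : (Fin n → ℝ) → Fin n → Fin n → ℝ)
    (γ2 : (Fin n → ℝ) → ℝ) (c d : (Fin n → ℝ) → Fin n → ℝ)
    (p : Fin n → ℝ) (i : Fin m) : ℝ :=
  ∑ j, ((if i = j then (1:ℝ) else 0) - ∑ k, Dmat η x θ γ2 p i k * η (x p) k j)
    * (∑ a, c p a * barD η ηi x (tv x d) p a j)

/-- `B_A^{ij} = −γ² ∇̂^i N_A^j`. -/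
noncomputable def Bmap (η ηi : (Fin m → ℝ) → Fin m → Fin m → ℝ)
    (x : (Fin n → ℝ) → Fin m → ℝ) (θ : (Fin n → ℝ) → Fin n → Fin n → ℝ)
    (γ2 : (Fin n → ℝ) → ℝ) (N : (Fin n → ℝ) → Fin m → ℝ)
    (p : Fin n → ℝ) (i j : Fin m) : ℝ :=
  - γ2 p * nhV η ηi x θ γ2 N p i j

/-- `N` is a smooth orthonormal frame of the normal bundle `TΣ^⊥` :
each `N_A` is a smooth unit normal field, they are mutually orthonormal, and they
are complete, i.e. `Σ_A N_A^i N_A^j = η^{ij} − D^{ij} = Π^{ij}`. -/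
def NormalFrame {r : ℕ} (η ηi : (Fin m → ℝ) → Fin m → Fin m → ℝ)
    (x : (Fin n → ℝ) → Fin m → ℝ) (θ : (Fin n → ℝ) → Fin n → Fin n → ℝ)
    (γ2 : (Fin n → ℝ) → ℝ) (N : Fin r → (Fin n → ℝ) → Fin m → ℝ) : Prop :=
  (∀ A i, ContDiff ℝ (⊤ : ℕ∞) fun q => N A q i) ∧
  (∀ A B p, ipM η x (N A) (N B) p = if A = B then (1:ℝ) else 0) ∧
  (∀ A p a, (∑ i, ∑ j, η (x p) i j * N A p i * pd a (fun q => x q j) p) = 0) ∧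
  (∀ p i j, (∑ A, N A p i * N A p j) = PiU η ηi x θ γ2 p i j)


/-! ### Calculus lemmas -/

def Sm {k : ℕ} (f : (Fin k → ℝ) → ℝ) : Prop := ContDiff ℝ (⊤ : ℕ∞) f

lemma Sm.diff {k : ℕ} {f : (Fin k → ℝ) → ℝ} (hf : Sm f) (p : Fin k → ℝ) :
    DifferentiableAt ℝ f p :=
  (ContDiff.differentiable hf (by simp)).differentiableAt

lemma Sm.pd {k : ℕ} {f : (Fin k → ℝ) → ℝ} (hf : Sm f) (a : Fin k) : Sm (pd a f) := by
  unfold Sm KP.pd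
  have h : ContDiff ℝ (⊤ : ℕ∞) (fderiv ℝ f) := ContDiff.fderiv_right hf (by simp)
  exact h.clm_apply contDiff_const

lemma Sm.add {k : ℕ} {f g : (Fin k → ℝ) → ℝ} (hf : Sm f) (hg : Sm g) :
    Sm (fun q => f q + g q) := ContDiff.add hf hg

lemma Sm.sub {k : ℕ} {f g : (Fin k → ℝ) → ℝ} (hf : Sm f) (hg : Sm g) :
    Sm (fun q => f q - g q) := ContDiff.sub hf hg

lemma Sm.mul {k : ℕ} {f g : (Fin k → ℝ) → ℝ} (hf : Sm f) (hg : Sm g) :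
    Sm (fun q => f q * g q) := ContDiff.mul hf hg

lemma Sm.const {k : ℕ} (c : ℝ) : Sm (fun _ : Fin k → ℝ => c) := contDiff_const

lemma Sm.sum {k : ℕ} {ι : Type*} [Fintype ι] {f : ι → (Fin k → ℝ) → ℝ} (hf : ∀ i, Sm (f i)) :
    Sm (fun q => ∑ i, f i q) := ContDiff.sum fun i _ => hf i

lemma Sm.comp {k l : ℕ} {f : (Fin l → ℝ) → ℝ} {x : (Fin k → ℝ) → Fin l → ℝ} (hf : Sm f)
    (hx : SmoothEmb x) : Sm (fun q => f (x q)) :=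
  ContDiff.comp hf (contDiff_pi.2 hx)

lemma pd_add {k : ℕ} {f g : (Fin k → ℝ) → ℝ} (hf : Sm f) (hg : Sm g) (a : Fin k)
    (p : Fin k → ℝ) : pd a (fun q => f q + g q) p = pd a f p + pd a g p := by
  unfold pd
  rw [fderiv_fun_add (hf.diff p) (hg.diff p)]; rfl

lemma pd_sub {k : ℕ} {f g : (Fin k → ℝ) → ℝ} (hf : Sm f) (hg : Sm g) (a : Fin k)
    (p : Fin k → ℝ) : pd a (fun q => f q - g q) p = pd a f p - pd a g p := by
  unfold pd
  rw [fderiv_fun_sub (hf.diff p) (hg.diff p)]; rfl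

lemma pd_mul {k : ℕ} {f g : (Fin k → ℝ) → ℝ} (hf : Sm f) (hg : Sm g) (a : Fin k)
    (p : Fin k → ℝ) : pd a (fun q => f q * g q) p = pd a f p * g p + f p * pd a g p := by
  unfold pd
  rw [fderiv_fun_mul (hf.diff p) (hg.diff p)]; simp; ring

lemma pd_const {k : ℕ} (c : ℝ) (a : Fin k) (p : Fin k → ℝ) : pd a (fun _ => c) p = 0 := by
  unfold pd; simp

lemma pd_sum {k : ℕ} {ι : Type*} [Fintype ι] {f : ι → (Fin k → ℝ) → ℝ} (hf : ∀ i, Sm (f i))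
    (a : Fin k) (p : Fin k → ℝ) : pd a (fun q => ∑ i, f i q) p = ∑ i, pd a (f i) p := by
  unfold pd
  rw [fderiv_fun_sum (fun i _ => (hf i).diff p)]; simp

lemma pd_comm {k : ℕ} {f : (Fin k → ℝ) → ℝ} (hf : Sm f) (a b : Fin k) (p : Fin k → ℝ) :
    pd a (pd b f) p = pd b (pd a f) p := by
  have h : ContDiff ℝ (⊤ : ℕ∞) (fderiv ℝ f) := ContDiff.fderiv_right hf (by simp)
  have hd : DifferentiableAt ℝ (fderiv ℝ f) p := (h.differentiable (by simp)).differentiableAt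
  have key : ∀ a b : Fin k, pd a (pd b f) p
      = fderiv ℝ (fderiv ℝ f) p (Pi.single a 1) (Pi.single b 1) := by
    intro a b
    unfold pd
    rw [fderiv_clm_apply hd (differentiableAt_const _)]
    simp
  rw [key, key]
  have hs : IsSymmSndFDerivAt ℝ f p :=
    (ContDiff.contDiffAt hf).isSymmSndFDerivAt (by
      simp only [minSmoothness_of_isRCLikeNormedField]; exact WithTop.coe_le_coe.2 (le_top : (2:ℕ∞) ≤ ⊤))
  exact hs _ _

lemma pd_comp {k l : ℕ} {f : (Fin l → ℝ) → ℝ} {x : (Fin k → ℝ) → Fin l → ℝ} (hf : Sm f)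
    (hx : SmoothEmb x) (a : Fin k) (p : Fin k → ℝ) :
    pd a (fun q => f (x q)) p = ∑ s, pd s f (x p) * pd a (fun q => x q s) p := by
  have hxd : DifferentiableAt ℝ x p := differentiableAt_pi.2 fun i => Sm.diff (hx i) p
  have h1 : fderiv ℝ (fun q => f (x q)) p = (fderiv ℝ f (x p)).comp (fderiv ℝ x p) :=
    fderiv_comp p (hf.diff (x p)) hxd
  unfold pd
  rw [h1]
  have h2 : fderiv ℝ x p (Pi.single a 1)
      = ∑ s, (fderiv ℝ (fun q => x q s) p (Pi.single a 1)) • (Pi.single s (1:ℝ) : Fin l → ℝ) := by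
    ext s
    rw [fderiv_pi (fun i => Sm.diff (hx i) p)]
    simp [Finset.sum_apply, Pi.single_apply]
  rw [ContinuousLinearMap.comp_apply, h2, map_sum]
  refine Finset.sum_congr rfl fun s _ => ?_
  rw [map_smul, smul_eq_mul, mul_comm]

/-- The inverse metric is smooth. -/
lemma IsMetric.sm_inv {k : ℕ} {g gi : (Fin k → ℝ) → Fin k → Fin k → ℝ} (h : IsMetric g gi)
    (i j : Fin k) : Sm (fun q => gi q i j) := by
  obtain ⟨hs, -, -, hinv⟩ := h
  have hmul : ∀ q, (Matrix.of (g q)) * (Matrix.of (gi q)) = 1 := by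
    intro q
    ext a b
    rw [Matrix.mul_apply, Matrix.one_apply]
    exact hinv q a b
  have hdet0 : ∀ q, (Matrix.of (g q)).det ≠ 0 := by
    intro q hq
    have := congrArg Matrix.det (hmul q)
    rw [Matrix.det_mul, hq] at this
    simp at this
  have hdets : ∀ M : (Fin k → ℝ) → Matrix (Fin k) (Fin k) ℝ, (∀ a b, Sm fun q => M q a b) →
      ContDiff ℝ (⊤ : ℕ∞) fun q => (M q).det := by
    intro M hM
    simp only [Matrix.det_apply]
    refine ContDiff.sum fun σ _ => ?_
    refine ContDiff.const_smul _ ?_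
    exact contDiff_prod fun a _ => hM _ _
  have heq : (fun q => gi q i j)
      = fun q => ((Matrix.of (g q)).det)⁻¹ * ((Matrix.of (g q)).updateRow j (Pi.single i 1)).det := by
    ext q
    have h1 : (Matrix.of (g q))⁻¹ = Matrix.of (gi q) := Matrix.inv_eq_right_inv (hmul q)
    have h2 : gi q i j = (Matrix.of (g q))⁻¹ i j := by rw [h1]; rfl
    rw [h2, Matrix.inv_def, Matrix.smul_apply, Matrix.adjugate_apply, smul_eq_mul,
      Ring.inverse_eq_inv']
  unfold Sm
  rw [heq]
  refine ContDiff.mul (ContDiff.inv (hdets _ fun a b => hs a b) hdet0) (hdets _ fun a b => ?_)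
  by_cases hab : a = j
  · subst hab
    simp only [Matrix.updateRow_self]
    exact Sm.const _
  · simp only [Matrix.updateRow_ne hab]
    exact hs a b

/-! ### Christoffel symbols and curvature -/

section amb
variable {k : ℕ} {g gi : (Fin k → ℝ) → Fin k → Fin k → ℝ}

lemma IsMetric.sm_chr (h : IsMetric g gi) (a b c : Fin k) : Sm (fun q => Chr g gi q a b c) := by
  have h1 := h.sm_inv
  have h2 : ∀ i j, Sm fun q => g q i j := h.1
  unfold Chr
  exact (Sm.const _).mul (Sm.sum fun d => (h1 a d).mul
    ((((h2 d c).pd b).add ((h2 d b).pd c)).sub ((h2 b c).pd d)))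

lemma IsMetric.chr_symm (h : IsMetric g gi) (q : Fin k → ℝ) (a b c : Fin k) :
    Chr g gi q a b c = Chr g gi q a c b := by
  unfold Chr
  congr 1
  refine Finset.sum_congr rfl fun d _ => ?_
  have : (fun r => g r b c) = fun r => g r c b := by ext r; exact h.2.1 r b c
  rw [this]; ring

/-- lowered Christoffel symbols -/
noncomputable def ChrL (g : (Fin k → ℝ) → Fin k → Fin k → ℝ) (q : Fin k → ℝ) (a b c : Fin k) : ℝ :=
  (1/2) * (pd b (fun r => g r a c) q + pd c (fun r => g r a b) q - pd a (fun r => g r b c) q)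

lemma IsMetric.chr_low (h : IsMetric g gi) (q : Fin k → ℝ) (a b c : Fin k) :
    ∑ e, g q a e * Chr g gi q e b c = ChrL g q a b c := by
  unfold Chr
  have : ∀ e, g q a e * ((1/2) * ∑ d, gi q e d *
    (pd b (fun r => g r d c) q + pd c (fun r => g r d b) q - pd d (fun r => g r b c) q))
    = ∑ d, (g q a e * gi q e d) * ChrL g q d b c := by
    intro e
    rw [Finset.mul_sum, Finset.mul_sum]
    refine Finset.sum_congr rfl fun d _ => ?_
    unfold ChrL; ring
  simp only [this]
  rw [Finset.sum_comm]
  simp only [← Finset.sum_mul, h.2.2.2]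
  simp

lemma IsMetric.compat (h : IsMetric g gi) (q : Fin k → ℝ) (a b c : Fin k) :
    pd c (fun r => g r a b) q = ChrL g q a c b + ChrL g q b c a := by
  unfold ChrL
  have hs : ∀ a b, (fun r => g r a b) = fun r => g r b a := fun a b => by
    ext r; exact h.2.1 r a b
  rw [hs b a, hs b c, hs c a]; ring

lemma IsMetric.sm_chrL (h : IsMetric g gi) (a b c : Fin k) : Sm (fun q => ChrL g q a b c) := by
  have h2 : ∀ i j, Sm fun q => g q i j := h.1
  unfold ChrL
  exact (Sm.const _).mul ((((h2 a c).pd b).add ((h2 a b).pd c)).sub ((h2 b c).pd a))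

lemma IsMetric.pd_chrL (h : IsMetric g gi) (q : Fin k → ℝ) (a b c d : Fin k) :
    pd d (fun q => ChrL g q a b c) q = (1/2) * (pd d (pd b (fun r => g r a c)) q
      + pd d (pd c (fun r => g r a b)) q - pd d (pd a (fun r => g r b c)) q) := by
  have h2 : ∀ i j, Sm fun q => g q i j := h.1
  unfold ChrL
  rw [pd_mul (Sm.const _) ((((h2 a c).pd b).add ((h2 a b).pd c)).sub ((h2 b c).pd a)),
    pd_sub (((h2 a c).pd b).add ((h2 a b).pd c)) ((h2 b c).pd a),
    pd_add ((h2 a c).pd b) ((h2 a b).pd c), pd_const]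
  ring

lemma IsMetric.low_pd_chr (h : IsMetric g gi) (q : Fin k → ℝ) (a b c d : Fin k) :
    ∑ e, g q a e * pd d (fun r => Chr g gi r e b c) q
      = pd d (fun r => ChrL g r a b c) q
        - ∑ e, (ChrL g q a d e + ChrL g q e d a) * Chr g gi q e b c := by
  have h2 : ∀ i j, Sm fun q => g q i j := h.1
  have : (fun r => ChrL g r a b c) = fun r => ∑ e, g r a e * Chr g gi r e b c := by
    ext r; rw [h.chr_low]
  rw [this, pd_sum (fun e => (h2 a e).mul (h.sm_chr e b c)), ← Finset.sum_sub_distrib]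
  refine Finset.sum_congr rfl fun e _ => ?_
  rw [pd_mul (h2 a e) (h.sm_chr e b c), h.compat]; ring

noncomputable def QQ (g gi : (Fin k → ℝ) → Fin k → Fin k → ℝ) (q : Fin k → ℝ) (a b c d : Fin k) : ℝ :=
  ∑ e, ChrL g q e a b * Chr g gi q e c d

lemma IsMetric.QQ_symm (h : IsMetric g gi) (q : Fin k → ℝ) (a b c d : Fin k) :
    QQ g gi q a b c d = QQ g gi q c d a b := by
  unfold QQ
  simp only [← h.chr_low, Finset.sum_mul]
  rw [Finset.sum_comm]
  refine Finset.sum_congr rfl fun e _ => Finset.sum_congr rfl fun f _ => ?_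
  rw [h.2.1 q e f]; ring

lemma IsMetric.QQ_symm2 (h : IsMetric g gi) (q : Fin k → ℝ) (a b c d : Fin k) :
    QQ g gi q a b c d = QQ g gi q a b d c := by
  unfold QQ
  simp only [h.chr_symm q _ c d]

lemma IsMetric.riemL_eq (h : IsMetric g gi) (q : Fin k → ℝ) (a b c d : Fin k) :
    RiemL g gi q a b c d = pd c (fun r => ChrL g r a d b) q - pd d (fun r => ChrL g r a c b) q
      - QQ g gi q c a d b + QQ g gi q d a c b := by
  unfold RiemL Riem
  have e1 : ∀ e, g q a e * (pd c (fun r => Chr g gi r e d b) q - pd d (fun r => Chr g gi r e c b) q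
      + ∑ f, (Chr g gi q e c f * Chr g gi q f d b - Chr g gi q e d f * Chr g gi q f c b))
      = g q a e * pd c (fun r => Chr g gi r e d b) q - g q a e * pd d (fun r => Chr g gi r e c b) q
       + (∑ f, (g q a e * Chr g gi q e c f) * Chr g gi q f d b
        - ∑ f, (g q a e * Chr g gi q e d f) * Chr g gi q f c b) := by
    intro e
    rw [mul_add, mul_sub, Finset.mul_sum, ← Finset.sum_sub_distrib]
    congr 1
    refine Finset.sum_congr rfl fun f _ => ?_
    ring
  rw [Finset.sum_congr rfl fun e _ => e1 e]
  simp only [Finset.sum_add_distrib, Finset.sum_sub_distrib, h.low_pd_chr]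
  rw [Finset.sum_comm (f := fun e f => (g q a e * Chr g gi q e c f) * Chr g gi q f d b),
    Finset.sum_comm (f := fun e f => (g q a e * Chr g gi q e d f) * Chr g gi q f c b)]
  simp only [← Finset.sum_mul, h.chr_low]
  unfold QQ
  simp only [add_mul, Finset.sum_add_distrib]
  ring

lemma IsMetric.bianchi (h : IsMetric g gi) (q : Fin k → ℝ) (a b c d : Fin k) :
    RiemL g gi q a b c d = RiemL g gi q b d a c - RiemL g gi q a d b c := by
  have hs : ∀ a b, (fun r => g r a b) = fun r => g r b a := fun a b => by
    ext r; exact h.2.1 r a b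
  have hc : ∀ i j a b, pd a (pd b (fun r => g r i j)) q = pd b (pd a (fun r => g r i j)) q :=
    fun i j a b => pd_comm (h.1 i j) a b q
  simp only [h.riemL_eq, h.pd_chrL]
  obtain ⟨P, hP⟩ : ∃ P : Fin k → Fin k → Fin k → Fin k → ℝ,
      ∀ i j a b, pd a (pd b (fun r => g r i j)) q = P i j a b := ⟨_, fun _ _ _ _ => rfl⟩
  have p1 : ∀ i j a b, P i j a b = P j i a b := fun i j a b => by rw [← hP, ← hP, hs]
  have p2 : ∀ i j a b, P i j a b = P i j b a := fun i j a b => by rw [← hP, ← hP, hc]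
  have q1 := h.QQ_symm q
  have q2 := h.QQ_symm2 q
  generalize QQ g gi q = Q at *
  simp only [hP]
  clear hP hc hs h
  grind

end amb

/-! ### Reordering finite sums -/

section sums
variable {A B C D : Type*} [Fintype A] [Fintype B] [Fintype C] [Fintype D]

lemma sum3 (f : A → B → C → ℝ) : ∑ a, ∑ b, ∑ c, f a b c = ∑ c, ∑ a, ∑ b, f a b c := by
  rw [Finset.sum_comm (s := (Finset.univ : Finset C))]
  exact Finset.sum_congr rfl fun a _ => Finset.sum_comm

lemma sum4 (f : A → B → C → D → ℝ) :
    ∑ a, ∑ b, ∑ c, ∑ d, f a b c d = ∑ d, ∑ a, ∑ b, ∑ c, f a b c d := by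
  rw [Finset.sum_comm (s := (Finset.univ : Finset D))]
  exact Finset.sum_congr rfl fun a _ => sum3 _

lemma sum_prod3 (u : A → ℝ) (v : B → ℝ) (w : C → ℝ) :
    ∑ a, ∑ b, ∑ c, u a * v b * w c = (∑ a, u a) * (∑ b, v b) * (∑ c, w c) := by
  simp only [← Finset.mul_sum, ← Finset.sum_mul]

end sums

/-! ### Geometry along the submanifold -/

section sub
variable {η ηi : (Fin m → ℝ) → Fin m → Fin m → ℝ} {x : (Fin n → ℝ) → Fin m → ℝ}
    {θ : (Fin n → ℝ) → Fin n → Fin n → ℝ} {γ2 : (Fin n → ℝ) → ℝ}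
    {gi : (Fin n → ℝ) → Fin n → Fin n → ℝ}

noncomputable def Et (x : (Fin n → ℝ) → Fin m → ℝ) (a : Fin n) (q : Fin n → ℝ) (i : Fin m) : ℝ :=
  pd a (fun r => x r i) q

noncomputable def Ed (x : (Fin n → ℝ) → Fin m → ℝ) (gi : (Fin n → ℝ) → Fin n → Fin n → ℝ)
    (a : Fin n) (q : Fin n → ℝ) (i : Fin m) : ℝ :=
  ∑ c, gi q a c * Et x c q i

/-- pulled back connection form -/
noncomputable def Ac (η ηi : (Fin m → ℝ) → Fin m → Fin m → ℝ) (x : (Fin n → ℝ) → Fin m → ℝ)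
    (a : Fin n) (q : Fin n → ℝ) (j l : Fin m) : ℝ :=
  ∑ k, Chr η ηi (x q) j k l * Et x a q k

lemma sm_Et (hx : SmoothEmb x) (a : Fin n) (i : Fin m) : Sm (fun q => Et x a q i) :=
  Sm.pd (hx i) a

lemma sm_Ed (hx : SmoothEmb x) (hg : Smooth2 gi) (a : Fin n) (i : Fin m) :
    Sm (fun q => Ed x gi a q i) :=
  Sm.sum fun c => Sm.mul (hg a c) (sm_Et hx c i)

lemma sm_Ac (hη : IsMetric η ηi) (hx : SmoothEmb x) (a : Fin n) (j l : Fin m) :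
    Sm (fun q => Ac η ηi x a q j l) :=
  Sm.sum fun k => Sm.mul ((hη.sm_chr j k l).comp hx) (sm_Et hx a k)

lemma barD_eq (V : (Fin n → ℝ) → Fin m → ℝ) (p : Fin n → ℝ) (a : Fin n) (j : Fin m) :
    barD η ηi x V p a j = pd a (fun q => V q j) p + ∑ l, Ac η ηi x a p j l * V p l := by
  unfold barD Ac Et
  rw [Finset.sum_comm]
  simp only [Finset.sum_mul]

lemma sm_barD (hη : IsMetric η ηi) (hx : SmoothEmb x) {V : (Fin n → ℝ) → Fin m → ℝ}
    (hV : ∀ i, Sm fun q => V q i) (a : Fin n) (j : Fin m) :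
    Sm (fun q => barD η ηi x V q a j) := by
  simp only [barD_eq]
  exact ((hV j).pd a).add (Sm.sum fun l => (sm_Ac hη hx a j l).mul (hV l))

lemma Dop_eq (h : IsAKP η x θ γ2 gi) (u : (Fin n → ℝ) → ℝ) (p : Fin n → ℝ) (i : Fin m) :
    Dop η x θ γ2 u p i = ∑ a, Ed x gi a p i * pd a u p := by
  obtain ⟨-, -, -, -, -, hpos, -, hg⟩ := h
  unfold Dop
  rw [inv_mul_eq_iff_eq_mul₀ (hpos p).ne']
  have hR : γ2 p * ∑ a, Ed x gi a p i * pd a u p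
      = ∑ a, ∑ c, (γ2 p * gi p a c) * Et x c p i * pd a u p := by
    rw [Finset.mul_sum]
    refine Finset.sum_congr rfl fun a _ => ?_
    unfold Ed
    rw [Finset.sum_mul, Finset.mul_sum]
    refine Finset.sum_congr rfl fun c _ => ?_
    ring
  rw [hR]
  simp only [hg]
  unfold pbr ind
  simp only [Finset.sum_mul, Finset.mul_sum]
  rw [sum3]
  conv_rhs => rw [Finset.sum_comm]
  refine Finset.sum_congr rfl fun c _ => ?_
  rw [sum4]
  refine Finset.sum_congr rfl fun a _ => ?_
  rw [sum4]
  refine Finset.sum_congr rfl fun b _ => ?_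
  rw [sum3]
  refine Finset.sum_congr rfl fun d _ => Finset.sum_congr rfl fun k _ =>
    Finset.sum_congr rfl fun l _ => ?_
  unfold Et
  ring

lemma aux_conn (h : IsAKP η x θ γ2 gi) (p : Fin n → ℝ) (i j : Fin m) (v : Fin m → ℝ) :
    ∑ k, ∑ l, Dmat η x θ γ2 p i k * Chr η ηi (x p) j k l * v l
      = ∑ a, Ed x gi a p i * ∑ l, Ac η ηi x a p j l * v l := by
  unfold Dmat
  simp only [Dop_eq h]
  unfold Ac Et
  simp only [Finset.sum_mul, Finset.mul_sum]
  rw [sum3]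
  refine Finset.sum_congr rfl fun a _ => ?_
  rw [Finset.sum_comm]
  refine Finset.sum_congr rfl fun l _ => Finset.sum_congr rfl fun k _ => ?_
  ring

lemma nhV_eq (h : IsAKP η x θ γ2 gi) (V : (Fin n → ℝ) → Fin m → ℝ) (p : Fin n → ℝ)
    (i j : Fin m) :
    nhV η ηi x θ γ2 V p i j = ∑ a, Ed x gi a p i * barD η ηi x V p a j := by
  unfold nhV
  rw [aux_conn h, Dop_eq h, ← Finset.sum_add_distrib]
  simp only [barD_eq, mul_add]

lemma nhT2_eq (h : IsAKP η x θ γ2 gi) (T : (Fin n → ℝ) → Fin m → Fin m → ℝ) (p : Fin n → ℝ)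
    (i j k : Fin m) :
    nhT2 η ηi x θ γ2 T p i j k = ∑ b, Ed x gi b p i * (pd b (fun q => T q j k) p
      + ∑ l, Ac η ηi x b p j l * T p l k + ∑ l, Ac η ηi x b p k l * T p j l) := by
  unfold nhT2
  rw [aux_conn h p i j (fun l => T p l k), aux_conn h p i k (fun l => T p j l), Dop_eq h,
    ← Finset.sum_add_distrib, ← Finset.sum_add_distrib]
  simp only [mul_add]

lemma nhT2_nhV (hη : IsMetric η ηi) (hx : SmoothEmb x) (h : IsAKP η x θ γ2 gi)
    {V : (Fin n → ℝ) → Fin m → ℝ} (hV : ∀ i, Sm fun q => V q i) (p : Fin n → ℝ)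
    (i j k : Fin m) :
    nhT2 η ηi x θ γ2 (fun q => nhV η ηi x θ γ2 V q) p i j k
      = ∑ b, Ed x gi b p i * ∑ a, (barD η ηi x (Ed x gi a) p b j * barD η ηi x V p a k
        + Ed x gi a p j * barD η ηi x (fun q => barD η ηi x V q a) p b k) := by
  have hgi : Smooth2 gi := h.2.2.2.1
  rw [nhT2_eq h]
  refine Finset.sum_congr rfl fun b _ => ?_
  congr 1
  have hT : ∀ q j k, nhV η ηi x θ γ2 V q j k = ∑ a, Ed x gi a q j * barD η ηi x V q a k :=
    fun q j k => nhV_eq h V q j k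
  simp only [hT]
  rw [pd_sum (fun a => (sm_Ed hx hgi a j).mul (sm_barD hη hx hV a k))]
  have e1 : ∑ l, Ac η ηi x b p j l * ∑ a, Ed x gi a p l * barD η ηi x V p a k
      = ∑ a, (∑ l, Ac η ηi x b p j l * Ed x gi a p l) * barD η ηi x V p a k := by
    simp only [Finset.mul_sum, Finset.sum_mul]
    rw [Finset.sum_comm]
    simp only [mul_assoc]
  have e2 : ∑ l, Ac η ηi x b p k l * ∑ a, Ed x gi a p j * barD η ηi x V p a l
      = ∑ a, Ed x gi a p j * ∑ l, Ac η ηi x b p k l * barD η ηi x V p a l := by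
    simp only [Finset.mul_sum]
    rw [Finset.sum_comm]
    refine Finset.sum_congr rfl fun a _ => Finset.sum_congr rfl fun l _ => ?_
    ring
  rw [e1, e2, ← Finset.sum_add_distrib, ← Finset.sum_add_distrib]
  refine Finset.sum_congr rfl fun a _ => ?_
  rw [pd_mul (sm_Ed hx hgi a j) (sm_barD hη hx hV a k), barD_eq (Ed x gi a),
    barD_eq (fun q => barD η ηi x V q a)]
  ring

lemma ind_symm (hη : IsMetric η ηi) (p : Fin n → ℝ) (a b : Fin n) :
    ind η x p a b = ind η x p b a := by
  unfold ind
  rw [Finset.sum_comm]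
  refine Finset.sum_congr rfl fun i _ => Finset.sum_congr rfl fun j _ => ?_
  rw [hη.2.1 (x p) i j]; ring

lemma gi_symm (hη : IsMetric η ηi) (h : IsAKP η x θ γ2 gi) (p : Fin n → ℝ) (a b : Fin n) :
    gi p a b = gi p b a := by
  obtain ⟨-, -, -, -, -, hpos, -, hg⟩ := h
  refine mul_left_cancel₀ (hpos p).ne' ?_
  rw [hg, hg, Finset.sum_comm]
  refine Finset.sum_congr rfl fun i _ => Finset.sum_congr rfl fun j _ => ?_
  rw [ind_symm hη]; ring

lemma orth (hη : IsMetric η ηi) (h : IsAKP η x θ γ2 gi) (p : Fin n → ℝ) (a b : Fin n) :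
    ipM η x (Ed x gi b) (Et x a) p = if a = b then 1 else 0 := by
  rw [← h.2.2.2.2.2.2.1 p a b]
  unfold ipM Ed ind Et
  simp only [Finset.sum_mul, Finset.mul_sum]
  rw [sum3]
  refine Finset.sum_congr rfl fun c _ => ?_
  rw [Finset.sum_comm]
  refine Finset.sum_congr rfl fun i _ => Finset.sum_congr rfl fun j _ => ?_
  rw [gi_symm hη h p b c, hη.2.1 (x p) i j]; ring

lemma low_tv (c : (Fin n → ℝ) → Fin n → ℝ) (p : Fin n → ℝ) (i : Fin m) :
    low η x (tv x c) p i = ∑ a, c p a * low η x (Et x a) p i := by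
  unfold low tv Et
  simp only [Finset.mul_sum]
  rw [Finset.sum_comm]
  refine Finset.sum_congr rfl fun a _ => Finset.sum_congr rfl fun j _ => ?_
  ring

lemma low_Ed (hη : IsMetric η ηi) (h : IsAKP η x θ γ2 gi) (c : (Fin n → ℝ) → Fin n → ℝ)
    (p : Fin n → ℝ) (b : Fin n) :
    ∑ i, low η x (tv x c) p i * Ed x gi b p i = c p b := by
  have : ∀ a, ∑ i, low η x (Et x a) p i * Ed x gi b p i = if a = b then 1 else 0 := by
    intro a
    rw [← orth hη h p a b]
    unfold low ipM
    simp only [Finset.sum_mul]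
    refine Finset.sum_congr rfl fun i _ => Finset.sum_congr rfl fun j _ => ?_
    ring
  simp only [low_tv, Finset.sum_mul]
  rw [Finset.sum_comm]
  simp only [mul_assoc, ← Finset.mul_sum, this]
  simp

lemma pd_eta (hη : IsMetric η ηi) (hx : SmoothEmb x) (p : Fin n → ℝ) (b : Fin n) (i j : Fin m) :
    pd b (fun q => η (x q) i j) p = ∑ e, η (x p) i e * Ac η ηi x b p e j
      + ∑ e, η (x p) j e * Ac η ηi x b p e i := by
  rw [pd_comp (f := fun y => η y i j) (hη.1 i j) hx]
  have : ∀ i j, ∑ e, η (x p) i e * Ac η ηi x b p e j = ∑ s, ChrL η (x p) i s j * Et x b p s := by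
    intro i j
    simp only [← hη.chr_low, Ac, Finset.sum_mul, Finset.mul_sum]
    rw [Finset.sum_comm]
    simp only [mul_assoc]
  rw [this, this, ← Finset.sum_add_distrib]
  refine Finset.sum_congr rfl fun s _ => ?_
  rw [hη.compat, add_mul]; rfl

lemma compat_along (hη : IsMetric η ηi) (hx : SmoothEmb x) {V W : (Fin n → ℝ) → Fin m → ℝ}
    (hV : ∀ i, Sm fun q => V q i) (hW : ∀ i, Sm fun q => W q i) (p : Fin n → ℝ) (b : Fin n) :
    pd b (ipM η x V W) p = ∑ i, ∑ j, η (x p) i j * barD η ηi x V p b i * W p j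
      + ∑ i, ∑ j, η (x p) i j * V p i * barD η ηi x W p b j := by
  have hs : ∀ i j, Sm fun q => η (x q) i j := fun i j =>
    Sm.comp (f := fun y => η y i j) (hη.1 i j) hx
  unfold ipM
  rw [pd_sum (fun i => Sm.sum fun j => ((hs i j).mul (hV i)).mul (hW j))]
  have e1 : ∀ i, pd b (fun q => ∑ j, η (x q) i j * V q i * W q j) p
      = ∑ j, ((∑ e, η (x p) i e * Ac η ηi x b p e j + ∑ e, η (x p) j e * Ac η ηi x b p e i)
          * V p i * W p j
        + η (x p) i j * pd b (fun q => V q i) p * W p j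
        + η (x p) i j * V p i * pd b (fun q => W q j) p) := by
    intro i
    rw [pd_sum (fun j => ((hs i j).mul (hV i)).mul (hW j))]
    refine Finset.sum_congr rfl fun j _ => ?_
    rw [pd_mul ((hs i j).mul (hV i)) (hW j), pd_mul (hs i j) (hV i), pd_eta hη hx]
    ring
  simp only [e1, barD_eq, mul_add, add_mul, Finset.sum_add_distrib]
  have f1 : ∑ i, ∑ j, (∑ e, η (x p) i e * Ac η ηi x b p e j) * V p i * W p j
      = ∑ i, ∑ j, η (x p) i j * V p i * ∑ l, Ac η ηi x b p j l * W p l := by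
    refine Finset.sum_congr rfl fun i _ => ?_
    simp only [Finset.sum_mul, Finset.mul_sum]
    rw [Finset.sum_comm]
    refine Finset.sum_congr rfl fun e _ => Finset.sum_congr rfl fun j _ => ?_
    ring
  have f2 : ∑ i, ∑ j, (∑ e, η (x p) j e * Ac η ηi x b p e i) * V p i * W p j
      = ∑ i, ∑ j, η (x p) i j * (∑ l, Ac η ηi x b p i l * V p l) * W p j := by
    simp only [Finset.sum_mul, Finset.mul_sum]
    rw [sum3]
    refine Finset.sum_congr rfl fun e _ => ?_
    rw [Finset.sum_comm]
    refine Finset.sum_congr rfl fun j _ => Finset.sum_congr rfl fun i _ => ?_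
    rw [hη.2.1 (x p) j e]; ring
  rw [f1, f2]; ring

lemma barD_Et_symm (hη : IsMetric η ηi) (hx : SmoothEmb x) (p : Fin n → ℝ) (a b : Fin n)
    (j : Fin m) : barD η ηi x (Et x a) p b j = barD η ηi x (Et x b) p a j := by
  unfold barD
  have : pd b (fun q => Et x a q j) p = pd a (fun q => Et x b q j) p := pd_comm (hx j) b a p
  rw [this, Finset.sum_comm]
  congr 1
  refine Finset.sum_congr rfl fun i _ => Finset.sum_congr rfl fun k _ => ?_
  rw [hη.chr_symm]; unfold Et; ring

/-- minus the induced Christoffel symbols -/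
noncomputable def g0 (η ηi : (Fin m → ℝ) → Fin m → Fin m → ℝ) (x : (Fin n → ℝ) → Fin m → ℝ)
    (gi : (Fin n → ℝ) → Fin n → Fin n → ℝ) (p : Fin n → ℝ) (f b a : Fin n) : ℝ :=
  ∑ k, low η x (Et x f) p k * barD η ηi x (Ed x gi a) p b k

lemma g0_symm (hη : IsMetric η ηi) (hx : SmoothEmb x) (h : IsAKP η x θ γ2 gi) (p : Fin n → ℝ)
    (f b a : Fin n) : g0 η ηi x gi p f b a = g0 η ηi x gi p b f a := by
  have key : ∀ f b, g0 η ηi x gi p f b a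
      = - ∑ i, ∑ j, η (x p) i j * Ed x gi a p i * barD η ηi x (Et x f) p b j := by
    intro f b
    have h1 := compat_along hη hx (sm_Ed hx h.2.2.2.1 a) (sm_Et hx f) p b
    have h2 : ipM η x (Ed x gi a) (Et x f) = fun _ => if f = a then (1:ℝ) else 0 := by
      ext q; exact orth hη h q f a
    rw [h2, pd_const] at h1
    have h3 : g0 η ηi x gi p f b a
        = ∑ i, ∑ j, η (x p) i j * barD η ηi x (Ed x gi a) p b i * Et x f p j := by
      unfold g0 low
      simp only [Finset.sum_mul]
      refine Finset.sum_congr rfl fun i _ => Finset.sum_congr rfl fun j _ => ?_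
      ring
    rw [h3]; linarith
  rw [key, key]
  simp only [barD_Et_symm hη hx p f b]

/-- Ricci identity along the submanifold -/
lemma ricci (hη : IsMetric η ηi) (hx : SmoothEmb x) {V : (Fin n → ℝ) → Fin m → ℝ}
    (hV : ∀ i, Sm fun q => V q i) (p : Fin n → ℝ) (a b : Fin n) (j : Fin m) :
    barD η ηi x (fun q => barD η ηi x V q a) p b j
      - barD η ηi x (fun q => barD η ηi x V q b) p a j
    = ∑ l, (∑ s, ∑ k, Riem η ηi (x p) j l s k * Et x b p s * Et x a p k) * V p l := by
  have hW : ∀ a b, barD η ηi x (fun q => barD η ηi x V q a) p b j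
      = pd b (pd a (fun q => V q j)) p
        + ∑ l, (pd b (fun q => Ac η ηi x a q j l) p * V p l
          + Ac η ηi x a p j l * pd b (fun q => V q l) p + Ac η ηi x b p j l * pd a (fun q => V q l) p)
        + ∑ l, (∑ s, Ac η ηi x b p j s * Ac η ηi x a p s l) * V p l := by
    intro a b
    rw [barD_eq]
    simp only [barD_eq]
    rw [pd_add ((hV j).pd a) (Sm.sum fun l => (sm_Ac hη hx a j l).mul (hV l)),
      pd_sum (fun l => (sm_Ac hη hx a j l).mul (hV l))]
    have e1 : ∀ l, pd b (fun q => Ac η ηi x a q j l * V q l) p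
        = pd b (fun q => Ac η ηi x a q j l) p * V p l
          + Ac η ηi x a p j l * pd b (fun q => V q l) p :=
      fun l => pd_mul (sm_Ac hη hx a j l) (hV l) b p
    have e2 : ∑ l, (∑ s, Ac η ηi x b p j s * Ac η ηi x a p s l) * V p l
        = ∑ l, Ac η ηi x b p j l * ∑ s, Ac η ηi x a p l s * V p s := by
      simp only [Finset.sum_mul, Finset.mul_sum]
      rw [Finset.sum_comm]
      simp only [mul_assoc]
    rw [e2]
    simp only [e1, mul_add, Finset.sum_add_distrib]
    ring
  have hA : ∀ a b l, pd b (fun q => Ac η ηi x a q j l) p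
      = ∑ s, ∑ k, pd s (fun y => Chr η ηi y j k l) (x p) * Et x b p s * Et x a p k
        + ∑ k, Chr η ηi (x p) j k l * pd b (pd a fun q => x q k) p := by
    intro a b l
    unfold Ac
    rw [pd_sum (fun k => Sm.mul ((hη.sm_chr j k l).comp hx) (sm_Et hx a k)), Finset.sum_comm,
      ← Finset.sum_add_distrib]
    refine Finset.sum_congr rfl fun k _ => ?_
    rw [pd_mul ((hη.sm_chr j k l).comp hx) (sm_Et hx a k), pd_comp (hη.sm_chr j k l) hx,
      Finset.sum_mul]
    rfl
  have hAA : ∀ a b l, ∑ s, Ac η ηi x b p j s * Ac η ηi x a p s l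
      = ∑ s, ∑ k, (∑ e, Chr η ηi (x p) j s e * Chr η ηi (x p) e k l) * Et x b p s * Et x a p k := by
    intro a b l
    unfold Ac
    simp only [Finset.sum_mul, Finset.mul_sum]
    rw [sum3]
    rw [Finset.sum_comm]
    conv_rhs => rw [sum3]
    refine Finset.sum_congr rfl fun e _ => Finset.sum_congr rfl fun s _ =>
      Finset.sum_congr rfl fun k _ => ?_
    ring
  have hR : ∀ l, ∑ s, ∑ k, Riem η ηi (x p) j l s k * Et x b p s * Et x a p k
      = (pd b (fun q => Ac η ηi x a q j l) p - pd a (fun q => Ac η ηi x b q j l) p)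
        + (∑ s, Ac η ηi x b p j s * Ac η ηi x a p s l - ∑ s, Ac η ηi x a p j s * Ac η ηi x b p s l) := by
    intro l
    rw [hA, hA, hAA, hAA]
    have hc : ∀ k, pd b (pd a fun q => x q k) p = pd a (pd b fun q => x q k) p :=
      fun k => pd_comm (hx k) b a p
    rw [Finset.sum_comm (f := fun s k => pd s (fun y => Chr η ηi y j k l) (x p) * Et x a p s * Et x b p k),
      Finset.sum_comm (f := fun s k => (∑ e, Chr η ηi (x p) j s e * Chr η ηi (x p) e k l) * Et x a p s * Et x b p k)]
    simp only [hc, add_sub_add_right_eq_sub, ← Finset.sum_sub_distrib, ← Finset.sum_add_distrib]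
    refine Finset.sum_congr rfl fun s _ => Finset.sum_congr rfl fun k _ => ?_
    unfold Riem
    rw [Finset.sum_sub_distrib]
    ring
  simp only [hR]
  rw [hW, hW, pd_comm (hV j) b a]
  simp only [add_mul, sub_mul, Finset.sum_add_distrib, Finset.sum_sub_distrib]
  ring

end sub

section final
variable {η ηi : (Fin m → ℝ) → Fin m → Fin m → ℝ} {x : (Fin n → ℝ) → Fin m → ℝ}
    {θ : (Fin n → ℝ) → Fin n → Fin n → ℝ} {γ2 : (Fin n → ℝ) → ℝ}
    {gi : (Fin n → ℝ) → Fin n → Fin n → ℝ}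

/-- `⟨Y, ∇_b ∇_a V⟩` -/
noncomputable def KK (η ηi : (Fin m → ℝ) → Fin m → Fin m → ℝ) (x V : (Fin n → ℝ) → Fin m → ℝ)
    (d : (Fin n → ℝ) → Fin n → ℝ) (p : Fin n → ℝ) (b a : Fin n) : ℝ :=
  ∑ j, low η x (tv x d) p j * barD η ηi x (fun q => barD η ηi x V q a) p b j

/-- `⟨Y, ∇_a V⟩` -/
noncomputable def HH (η ηi : (Fin m → ℝ) → Fin m → Fin m → ℝ) (x V : (Fin n → ℝ) → Fin m → ℝ)
    (d : (Fin n → ℝ) → Fin n → ℝ) (p : Fin n → ℝ) (a : Fin n) : ℝ :=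
  ∑ j, low η x (tv x d) p j * barD η ηi x V p a j

lemma contr (hη : IsMetric η ηi) (hx : SmoothEmb x) (h : IsAKP η x θ γ2 gi)
    {V : (Fin n → ℝ) → Fin m → ℝ} (hV : ∀ i, Sm fun q => V q i)
    (c d e : (Fin n → ℝ) → Fin n → ℝ) (p : Fin n → ℝ) :
    ∑ i, ∑ j, ∑ k, low η x (tv x c) p i * low η x (tv x d) p j * low η x (tv x e) p k
      * nhT2 η ηi x θ γ2 (fun q => nhV η ηi x θ γ2 V q) p i k j
    = ∑ b, ∑ f, ∑ a, c p b * e p f * g0 η ηi x gi p f b a * HH η ηi x V d p a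
      + ∑ b, ∑ a, c p b * e p a * KK η ηi x V d p b a := by
  have hG : ∀ b a, ∑ k, low η x (tv x e) p k * barD η ηi x (Ed x gi a) p b k
      = ∑ f, e p f * g0 η ηi x gi p f b a := by
    intro b a
    unfold g0
    simp only [low_tv, Finset.sum_mul, Finset.mul_sum]
    rw [Finset.sum_comm]
    simp only [mul_assoc]
  have step : ∀ i j k, low η x (tv x c) p i * low η x (tv x d) p j * low η x (tv x e) p k
      * nhT2 η ηi x θ γ2 (fun q => nhV η ηi x θ γ2 V q) p i k j
      = ∑ b, ∑ a, ((low η x (tv x c) p i * Ed x gi b p i)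
          * (low η x (tv x d) p j * barD η ηi x V p a j)
          * (low η x (tv x e) p k * barD η ηi x (Ed x gi a) p b k)
        + (low η x (tv x c) p i * Ed x gi b p i)
          * (low η x (tv x d) p j * barD η ηi x (fun q => barD η ηi x V q a) p b j)
          * (low η x (tv x e) p k * Ed x gi a p k)) := by
    intro i j k
    rw [nhT2_nhV hη hx h hV]
    simp only [Finset.mul_sum]
    refine Finset.sum_congr rfl fun b _ => Finset.sum_congr rfl fun a _ => ?_
    ring
  simp only [step]
  rw [sum4]
  have e2 : ∑ b, ∑ f, ∑ a, c p b * e p f * g0 η ηi x gi p f b a * HH η ηi x V d p a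
      = ∑ b, ∑ a, c p b * HH η ηi x V d p a * ∑ f, e p f * g0 η ηi x gi p f b a := by
    refine Finset.sum_congr rfl fun b _ => ?_
    rw [Finset.sum_comm]
    refine Finset.sum_congr rfl fun a _ => ?_
    rw [Finset.mul_sum]
    refine Finset.sum_congr rfl fun f _ => ?_
    ring
  rw [e2, ← Finset.sum_add_distrib]
  refine Finset.sum_congr rfl fun b _ => ?_
  rw [sum4, ← Finset.sum_add_distrib]
  refine Finset.sum_congr rfl fun a _ => ?_
  simp only [Finset.sum_add_distrib]
  rw [sum_prod3, sum_prod3, low_Ed hη h, low_Ed hη h, hG]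
  unfold HH KK
  ring

/-- evaluation of the curvature tensor -/
noncomputable def R4 (η ηi : (Fin m → ℝ) → Fin m → Fin m → ℝ) (y : Fin m → ℝ)
    (X Y Z W : Fin m → ℝ) : ℝ :=
  ∑ i, ∑ j, ∑ k, ∑ l, X i * Y j * Z k * W l * RiemL η ηi y i j k l

lemma KK_diff (hη : IsMetric η ηi) (hx : SmoothEmb x)
    {V : (Fin n → ℝ) → Fin m → ℝ} (hV : ∀ i, Sm fun q => V q i)
    (c d e : (Fin n → ℝ) → Fin n → ℝ) (p : Fin n → ℝ) :
    ∑ b, ∑ a, c p b * e p a * KK η ηi x V d p b a - ∑ b, ∑ a, e p b * c p a * KK η ηi x V d p b a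
      = R4 η ηi (x p) (tv x d p) (V p) (tv x c p) (tv x e p) := by
  rw [Finset.sum_comm (f := fun b a => e p b * c p a * KK η ηi x V d p b a)]
  simp only [← Finset.sum_sub_distrib]
  have e1 : ∀ b a, c p b * e p a * KK η ηi x V d p b a - e p a * c p b * KK η ηi x V d p a b
      = ∑ j, ∑ l, ∑ s, ∑ k, low η x (tv x d) p j * V p l * (c p b * Et x b p s)
        * (e p a * Et x a p k) * Riem η ηi (x p) j l s k := by
    intro b a
    have : c p b * e p a * KK η ηi x V d p b a - e p a * c p b * KK η ηi x V d p a b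
      = c p b * e p a * (KK η ηi x V d p b a - KK η ηi x V d p a b) := by ring
    rw [this]
    unfold KK
    rw [← Finset.sum_sub_distrib]
    simp only [← mul_sub, ricci hη hx hV]
    simp only [Finset.mul_sum, Finset.sum_mul]
    refine Finset.sum_congr rfl fun j _ => Finset.sum_congr rfl fun l _ =>
      Finset.sum_congr rfl fun s _ => Finset.sum_congr rfl fun k _ => ?_
    ring
  simp only [e1]
  have e2 : R4 η ηi (x p) (tv x d p) (V p) (tv x c p) (tv x e p)
      = ∑ j, ∑ l, ∑ s, ∑ k, low η x (tv x d) p j * V p l * tv x c p s * tv x e p k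
        * Riem η ηi (x p) j l s k := by
    unfold R4 RiemL low
    simp only [Finset.mul_sum, Finset.sum_mul]
    have e3 : ∀ i : Fin m, ∑ j : Fin m, ∑ k : Fin m, ∑ l : Fin m, ∑ f : Fin m,
        tv x d p i * V p j * tv x c p k * tv x e p l * (η (x p) i f * Riem η ηi (x p) f j k l)
        = ∑ f, ∑ j, ∑ k, ∑ l,
        tv x d p i * V p j * tv x c p k * tv x e p l * (η (x p) i f * Riem η ηi (x p) f j k l) := by
      intro i
      rw [Finset.sum_comm (s := (Finset.univ : Finset (Fin m))) (f := fun f j => ∑ k, ∑ l,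
        tv x d p i * V p j * tv x c p k * tv x e p l * (η (x p) i f * Riem η ηi (x p) f j k l))]
      exact Finset.sum_congr rfl fun j _ => sum3 _
    simp only [e3]
    rw [Finset.sum_comm]
    refine Finset.sum_congr rfl fun f _ => ?_
    rw [← sum4 (fun j k l i => tv x d p i * V p j * tv x c p k * tv x e p l
      * (η (x p) i f * Riem η ηi (x p) f j k l))]
    refine Finset.sum_congr rfl fun j _ => Finset.sum_congr rfl fun k _ =>
      Finset.sum_congr rfl fun l _ => Finset.sum_congr rfl fun i _ => ?_
    rw [hη.2.1 (x p) i f]; ring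
  rw [e2]
  have e4 : ∀ F : Fin n → Fin n → Fin m → Fin m → Fin m → Fin m → ℝ,
      ∑ b, ∑ a, ∑ j, ∑ l, ∑ s, ∑ k, F b a j l s k
      = ∑ j, ∑ l, ∑ s, ∑ k, ∑ b, ∑ a, F b a j l s k := by
    intro F
    rw [sum3]
    refine Finset.sum_congr rfl fun j _ => ?_
    rw [sum3]
    refine Finset.sum_congr rfl fun l _ => ?_
    rw [sum3]
    refine Finset.sum_congr rfl fun s _ => ?_
    rw [sum3]
  rw [e4]
  refine Finset.sum_congr rfl fun j _ => Finset.sum_congr rfl fun l _ =>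
    Finset.sum_congr rfl fun s _ => Finset.sum_congr rfl fun k _ => ?_
  unfold tv
  simp only [← Finset.sum_mul, ← Finset.mul_sum]
  rfl

end final
/-- The Codazzi–Mainardi equations in Poisson-bracket form:
for tangent `X,Y,Z` (coefficients `c,d,e`) and each normal `N_A`,
`X^iY^jZ^k N_A^l R̄_{ijkl}
  = X_iY_jZ_k [∇̂^i∇̂^k N_A^j − ∇̂^j∇̂^k N_A^i + ∇̂^k∇̂^j N_A^i − ∇̂^k∇̂^i N_A^j]`. -/
theorem statement_8 {n m r : ℕ}
    (η ηi : (Fin m → ℝ) → Fin m → Fin m → ℝ) (x : (Fin n → ℝ) → Fin m → ℝ)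
    (θ : (Fin n → ℝ) → Fin n → Fin n → ℝ) (γ2 : (Fin n → ℝ) → ℝ)
    (gi : (Fin n → ℝ) → Fin n → Fin n → ℝ)
    (N : Fin r → (Fin n → ℝ) → Fin m → ℝ)
    (hη : IsMetric η ηi) (hx : SmoothEmb x) (hakp : IsAKP η x θ γ2 gi)
    (hN : NormalFrame η ηi x θ γ2 N) :
    ∀ (A : Fin r) (c d e : (Fin n → ℝ) → Fin n → ℝ) (p : Fin n → ℝ),
      (∑ i, ∑ j, ∑ k, ∑ l, tv x c p i * tv x d p j * tv x e p k * N A p l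
          * RiemL η ηi (x p) i j k l)
        = ∑ i, ∑ j, ∑ k, low η x (tv x c) p i * low η x (tv x d) p j * low η x (tv x e) p k
            * (nhT2 η ηi x θ γ2 (fun q => nhV η ηi x θ γ2 (N A) q) p i k j
               - nhT2 η ηi x θ γ2 (fun q => nhV η ηi x θ γ2 (N A) q) p j k i
               + nhT2 η ηi x θ γ2 (fun q => nhV η ηi x θ γ2 (N A) q) p k j i
               - nhT2 η ηi x θ γ2 (fun q => nhV η ηi x θ γ2 (N A) q) p k i j) := by
  intro A c d e p
  have hV : ∀ i, Sm fun q => N A q i := hN.1 A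
  have C := contr hη hx hakp hV
  have hR : ∑ i, ∑ j, ∑ k, low η x (tv x c) p i * low η x (tv x d) p j * low η x (tv x e) p k
            * (nhT2 η ηi x θ γ2 (fun q => nhV η ηi x θ γ2 (N A) q) p i k j
               - nhT2 η ηi x θ γ2 (fun q => nhV η ηi x θ γ2 (N A) q) p j k i
               + nhT2 η ηi x θ γ2 (fun q => nhV η ηi x θ γ2 (N A) q) p k j i
               - nhT2 η ηi x θ γ2 (fun q => nhV η ηi x θ γ2 (N A) q) p k i j)
      = R4 η ηi (x p) (tv x d p) (N A p) (tv x c p) (tv x e p)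
        - R4 η ηi (x p) (tv x c p) (N A p) (tv x d p) (tv x e p) := by
    have c1 := C c d e p
    have c2 := C d c e p
    have c3 := C e c d p
    have c4 := C e d c p
    have r2 : ∑ i, ∑ j, ∑ k, low η x (tv x c) p i * low η x (tv x d) p j * low η x (tv x e) p k
        * nhT2 η ηi x θ γ2 (fun q => nhV η ηi x θ γ2 (N A) q) p j k i
      = ∑ i, ∑ j, ∑ k, low η x (tv x d) p i * low η x (tv x c) p j * low η x (tv x e) p k
        * nhT2 η ηi x θ γ2 (fun q => nhV η ηi x θ γ2 (N A) q) p i k j := by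
      rw [Finset.sum_comm]
      refine Finset.sum_congr rfl fun i _ => Finset.sum_congr rfl fun j _ =>
        Finset.sum_congr rfl fun k _ => ?_
      ring
    have r3 : ∑ i, ∑ j, ∑ k, low η x (tv x c) p i * low η x (tv x d) p j * low η x (tv x e) p k
        * nhT2 η ηi x θ γ2 (fun q => nhV η ηi x θ γ2 (N A) q) p k j i
      = ∑ i, ∑ j, ∑ k, low η x (tv x e) p i * low η x (tv x c) p j * low η x (tv x d) p k
        * nhT2 η ηi x θ γ2 (fun q => nhV η ηi x θ γ2 (N A) q) p i k j := by
      rw [sum3]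
      refine Finset.sum_congr rfl fun i _ => Finset.sum_congr rfl fun j _ =>
        Finset.sum_congr rfl fun k _ => ?_
      ring
    have r4 : ∑ i, ∑ j, ∑ k, low η x (tv x c) p i * low η x (tv x d) p j * low η x (tv x e) p k
        * nhT2 η ηi x θ γ2 (fun q => nhV η ηi x θ γ2 (N A) q) p k i j
      = ∑ i, ∑ j, ∑ k, low η x (tv x e) p i * low η x (tv x d) p j * low η x (tv x c) p k
        * nhT2 η ηi x θ γ2 (fun q => nhV η ηi x θ γ2 (N A) q) p i k j := by
      rw [sum3]
      refine Finset.sum_congr rfl fun i _ => ?_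
      rw [Finset.sum_comm]
      refine Finset.sum_congr rfl fun j _ =>
        Finset.sum_congr rfl fun k _ => ?_
      ring
    have s : ∀ c d e : (Fin n → ℝ) → Fin n → ℝ,
        ∑ b, ∑ f, ∑ a, c p b * e p f * g0 η ηi x gi p f b a * HH η ηi x (N A) d p a
        = ∑ b, ∑ f, ∑ a, e p b * c p f * g0 η ηi x gi p f b a * HH η ηi x (N A) d p a := by
      intro c d e
      rw [Finset.sum_comm]
      refine Finset.sum_congr rfl fun i _ => Finset.sum_congr rfl fun j _ =>
        Finset.sum_congr rfl fun k _ => ?_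
      rw [g0_symm hη hx hakp]; ring
    have k1 := KK_diff hη hx hV c d e p
    have k2 := KK_diff hη hx hV d c e p
    have s1 := s c d e
    have s2 := s d c e
    simp only [mul_add, mul_sub, Finset.sum_add_distrib, Finset.sum_sub_distrib]
    rw [r2, r3, r4]
    linarith
  rw [hR]
  unfold R4
  have q1 : ∑ i, ∑ j, ∑ k, ∑ l, tv x d p i * N A p j * tv x c p k * tv x e p l
        * RiemL η ηi (x p) i j k l
      = ∑ i, ∑ j, ∑ k, ∑ l, tv x c p i * tv x d p j * tv x e p k * N A p l
        * RiemL η ηi (x p) j l i k := by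
    rw [sum3]
    refine Finset.sum_congr rfl fun i _ => Finset.sum_congr rfl fun j _ => ?_
    rw [Finset.sum_comm]
    refine Finset.sum_congr rfl fun k _ => Finset.sum_congr rfl fun l _ => ?_
    ring
  have q2 : ∑ i, ∑ j, ∑ k, ∑ l, tv x c p i * N A p j * tv x d p k * tv x e p l
        * RiemL η ηi (x p) i j k l
      = ∑ i, ∑ j, ∑ k, ∑ l, tv x c p i * tv x d p j * tv x e p k * N A p l
        * RiemL η ηi (x p) i l j k := by
    refine Finset.sum_congr rfl fun i _ => ?_
    rw [Finset.sum_comm]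
    refine Finset.sum_congr rfl fun j _ => ?_
    rw [Finset.sum_comm]
    refine Finset.sum_congr rfl fun k _ => Finset.sum_congr rfl fun l _ => ?_
    ring
  rw [q1, q2]
  simp only [← Finset.sum_sub_distrib]
  refine Finset.sum_congr rfl fun i _ => Finset.sum_congr rfl fun j _ =>
    Finset.sum_congr rfl fun k _ => Finset.sum_congr rfl fun l _ => ?_
  rw [hη.bianchi (x p) i j k l]; ring

end KP
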